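/- arXiv:1910.07935 — 3 statements merged into one kernel-verified Lean document; each statement's English description precedes it below -/
import Mathlib

section
/- Let n ≥ 3, let e_j = (cos(2πj/n), sin(2πj/n)) ∈ ℝ² for j = 0, …, n−1 be a regular star of unit vectors, and fix offsets γ_0, …, γ_{n−1} ∈ ℝ. Define the de Bruijn dual map f : ℝ² → ℝ² by f(z) = Σ_{j<n} ⌈⟨z, e_j⟩ − γ_j⌉ · e_j, where ⌈·⌉ denotes the ceiling function and ⟨·,·⟩ the Euclidean inner product. Then f differs from the linear map z ↦ (n/2)·z by a uniformly bounded amount: for every z ∈ ℝ², ‖f(z) − (n/2)·z‖ ≤ Σ_{j<n} (1 + |γ_j|). -/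
theorem star_double_angle_sums (n : ℕ) (hn : 3 ≤ n) :
    ∑ j : Fin n, Real.cos (2 * (2 * Real.pi * ((j : ℕ) : ℝ) / (n : ℝ))) = 0 ∧
    ∑ j : Fin n, Real.sin (2 * (2 * Real.pi * ((j : ℕ) : ℝ) / (n : ℝ))) = 0 := by
  have hζ := Complex.isPrimitiveRoot_exp n (by omega)
  set ζ := Complex.exp (2 * Real.pi * Complex.I / n) with hζd
  have hne : ζ ^ 2 ≠ 1 := hζ.pow_ne_one_of_pos_of_lt (by norm_num) (by omega)
  have hs : ∑ j ∈ Finset.range n, (ζ ^ 2) ^ j = 0 := by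
    rw [geom_sum_eq hne, ← pow_mul, mul_comm 2 n, pow_mul, hζ.pow_eq_one]
    simp
  rw [← Fin.sum_univ_eq_sum_range (fun j => (ζ ^ 2) ^ j) n] at hs
  have key : ∀ j : Fin n, (ζ ^ 2) ^ (j : ℕ) =
      Complex.exp (((2 * (2 * Real.pi * ((j : ℕ) : ℝ) / (n : ℝ)) : ℝ) : ℂ) * Complex.I) := by
    intro j
    rw [hζd, ← Complex.exp_nat_mul, ← Complex.exp_nat_mul]
    congr 1
    push_cast
    ring
  simp_rw [key] at hs
  constructor
  · have := congrArg Complex.re hs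
    simpa only [Complex.re_sum, Complex.exp_ofReal_mul_I_re, Complex.zero_re] using this
  · have := congrArg Complex.im hs
    simpa only [Complex.im_sum, Complex.exp_ofReal_mul_I_im, Complex.zero_im] using this

theorem star_frame (n : ℕ) (hn : 3 ≤ n)
    (e : Fin n → EuclideanSpace ℝ (Fin 2))
    (he : ∀ j : Fin n, e j = (WithLp.equiv 2 (Fin 2 → ℝ)).symm
      ![Real.cos (2 * Real.pi * ((j : ℕ) : ℝ) / (n : ℝ)),
        Real.sin (2 * Real.pi * ((j : ℕ) : ℝ) / (n : ℝ))])
    (z : EuclideanSpace ℝ (Fin 2)) :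
    ∑ j : Fin n, (inner ℝ z (e j) : ℝ) • e j = ((n : ℝ) / 2) • z := by
  obtain ⟨hc, hs⟩ := star_double_angle_sums n hn
  set θ : Fin n → ℝ := fun j => 2 * Real.pi * ((j : ℕ) : ℝ) / (n : ℝ) with hθ
  have h0 : ∀ j, e j 0 = Real.cos (θ j) := fun j => by rw [he]; rfl
  have h1 : ∀ j, e j 1 = Real.sin (θ j) := fun j => by rw [he]; rfl
  have hin : ∀ j, (inner ℝ z (e j) : ℝ) = z 0 * Real.cos (θ j) + z 1 * Real.sin (θ j) := by
    intro j
    rw [← h0, ← h1]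
    simp [PiLp.inner_apply, Fin.sum_univ_two]
    ring
  change ∑ j, Real.cos (2 * θ j) = 0 at hc
  change ∑ j, Real.sin (2 * θ j) = 0 at hs
  have e0 : ∑ j, (z 0 * Real.cos (θ j) + z 1 * Real.sin (θ j)) * Real.cos (θ j)
      = (n : ℝ) / 2 * z 0 := by
    have : ∀ j, (z 0 * Real.cos (θ j) + z 1 * Real.sin (θ j)) * Real.cos (θ j)
        = z 0 / 2 + z 0 / 2 * Real.cos (2 * θ j) + z 1 / 2 * Real.sin (2 * θ j) := by
      intro j
      rw [Real.cos_two_mul, Real.sin_two_mul]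
      ring
    simp_rw [this, Finset.sum_add_distrib, ← Finset.mul_sum, hc, hs]
    simp
    ring
  have e1 : ∑ j, (z 0 * Real.cos (θ j) + z 1 * Real.sin (θ j)) * Real.sin (θ j)
      = (n : ℝ) / 2 * z 1 := by
    have : ∀ j, (z 0 * Real.cos (θ j) + z 1 * Real.sin (θ j)) * Real.sin (θ j)
        = z 1 / 2 - z 1 / 2 * Real.cos (2 * θ j) + z 0 / 2 * Real.sin (2 * θ j) := by
      intro j
      rw [Real.cos_two_mul, Real.sin_two_mul]
      linear_combination z 1 * Real.sin_sq_add_cos_sq (θ j)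
    simp_rw [this, Finset.sum_add_distrib, Finset.sum_sub_distrib, ← Finset.mul_sum, hc, hs]
    simp
    ring
  ext i
  fin_cases i
  · simpa [hin, h0] using e0
  · simpa [hin, h1] using e1

/-- The de Bruijn dual map `f z = Σ_j ⌈⟨z, e_j⟩ − γ_j⌉ e_j` of a multigrid with a
regular star of `n ≥ 3` unit vectors differs from the linear map `z ↦ (n/2)·z`
by at most `Σ_j (1 + |γ_j|)`. -/
theorem deBruijn_dual_map_near_linear
    (n : ℕ) (hn : 3 ≤ n)
    (e : Fin n → EuclideanSpace ℝ (Fin 2))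
    (he : ∀ j : Fin n, e j = (WithLp.equiv 2 (Fin 2 → ℝ)).symm
      ![Real.cos (2 * Real.pi * ((j : ℕ) : ℝ) / (n : ℝ)),
        Real.sin (2 * Real.pi * ((j : ℕ) : ℝ) / (n : ℝ))])
    (γ : Fin n → ℝ)
    (f : EuclideanSpace ℝ (Fin 2) → EuclideanSpace ℝ (Fin 2))
    (hf : ∀ z : EuclideanSpace ℝ (Fin 2),
      f z = ∑ j : Fin n, ((⌈(inner ℝ z (e j) : ℝ) - γ j⌉ : ℤ) : ℝ) • e j) :
    ∀ z : EuclideanSpace ℝ (Fin 2),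
      ‖f z - ((n : ℝ) / 2) • z‖ ≤ ∑ j : Fin n, (1 + |γ j|) := by
  intro z
  have hnorm : ∀ j, ‖e j‖ = 1 := by
    intro j
    rw [he, EuclideanSpace.norm_eq]
    simp [Fin.sum_univ_two]
  rw [hf, ← star_frame n hn e he z, ← Finset.sum_sub_distrib]
  refine (norm_sum_le _ _).trans (Finset.sum_le_sum fun j _ => ?_)
  rw [← sub_smul, norm_smul, hnorm, mul_one, Real.norm_eq_abs]
  have h1 := Int.le_ceil ((inner ℝ z (e j) : ℝ) - γ j)
  have h2 := Int.ceil_lt_add_one ((inner ℝ z (e j) : ℝ) - γ j)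
  have h3 := le_abs_self (γ j)
  have h4 := neg_abs_le (γ j)
  rw [abs_le]
  constructor <;> linarith
end

section
/- Let n ≥ 3, let e_j = (cos(2πj/n), sin(2πj/n)) ∈ ℝ² for j = 0, …, n−1 be a regular star of unit vectors, fix offsets γ_0, …, γ_{n−1} ∈ ℝ, and define the de Bruijn dual map f : ℝ² → ℝ² by f(z) = Σ_{j<n} ⌈⟨z, e_j⟩ − γ_j⌉ · e_j. Fix a family index j₀ < n and an integer m, and consider the grid line ℓ = { z ∈ ℝ² : ⟨z, e_{j₀}⟩ = m + γ_{j₀} }, whose dual is a stack of the tiling. Then the image of ℓ under f is well-behaved: for all z, z′ ∈ ℓ, the distance from f(z′) to the line through f(z) with direction e_{j₀} rotated by π/2 is at most 2·Σ_{j<n} (1 + |γ_j|). -/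
theorem sum_cos_sin_aux (n : ℕ) (hn : 3 ≤ n) :
    (∑ j : Fin n, Real.cos (2 * (2 * Real.pi * ((j : ℕ) : ℝ) / (n : ℝ))) = 0) ∧
    (∑ j : Fin n, Real.sin (2 * (2 * Real.pi * ((j : ℕ) : ℝ) / (n : ℝ))) = 0) := by
  have hp := Complex.isPrimitiveRoot_exp n (by omega)
  set ζ := Complex.exp (2 * Real.pi * Complex.I / n) with hζ
  have h1 : ζ ^ 2 ≠ 1 := hp.pow_ne_one_of_pos_of_lt (by norm_num) (by omega)
  have h2 : ∑ j ∈ Finset.range n, (ζ ^ 2) ^ j = 0 := by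
    have h := mul_neg_geom_sum (ζ ^ 2) n
    rw [← pow_mul, mul_comm 2 n, pow_mul, hp.pow_eq_one, one_pow, sub_self] at h
    rcases mul_eq_zero.mp h with h | h
    · exact absurd (sub_eq_zero.mp h).symm h1
    · exact h
  rw [← Fin.sum_univ_eq_sum_range (fun j => (ζ ^ 2) ^ j)] at h2
  have h3 : ∀ j : Fin n, (ζ ^ 2) ^ (j : ℕ) =
      Complex.exp (((2 * (2 * Real.pi * ((j : ℕ) : ℝ) / (n : ℝ)) : ℝ) : ℂ) * Complex.I) := by
    intro j
    rw [hζ, ← pow_mul, ← Complex.exp_nat_mul]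
    congr 1
    push_cast
    ring
  simp only [h3] at h2
  constructor
  · have := congrArg Complex.re h2
    simpa only [Complex.re_sum, Complex.exp_ofReal_mul_I_re, Complex.zero_re] using this
  · have := congrArg Complex.im h2
    simpa only [Complex.im_sum, Complex.exp_ofReal_mul_I_im, Complex.zero_im] using this

/-- The image under the de Bruijn dual map `f` of a single grid line of family `j₀`
(a stack of the dual tiling) is well-behaved: every image point lies within
distance `2·Σ_j (1 + |γ_j|)` of the line through `f z` in the direction `e_{j₀}`
rotated by `π/2`. -/
theorem deBruijn_dual_stack_well_behaved
    (n : ℕ) (hn : 3 ≤ n)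
    (e : Fin n → EuclideanSpace ℝ (Fin 2))
    (he : ∀ j : Fin n, e j = (WithLp.equiv 2 (Fin 2 → ℝ)).symm
      ![Real.cos (2 * Real.pi * ((j : ℕ) : ℝ) / (n : ℝ)),
        Real.sin (2 * Real.pi * ((j : ℕ) : ℝ) / (n : ℝ))])
    (γ : Fin n → ℝ)
    (f : EuclideanSpace ℝ (Fin 2) → EuclideanSpace ℝ (Fin 2))
    (hf : ∀ z : EuclideanSpace ℝ (Fin 2),
      f z = ∑ j : Fin n, ((⌈(inner ℝ z (e j) : ℝ) - γ j⌉ : ℤ) : ℝ) • e j)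
    (j₀ : Fin n) (m : ℤ)
    (u : EuclideanSpace ℝ (Fin 2))
    (hu : u = (WithLp.equiv 2 (Fin 2 → ℝ)).symm
      ![-Real.sin (2 * Real.pi * ((j₀ : ℕ) : ℝ) / (n : ℝ)),
        Real.cos (2 * Real.pi * ((j₀ : ℕ) : ℝ) / (n : ℝ))]) :
    ∀ z z' : EuclideanSpace ℝ (Fin 2),
      (inner ℝ z (e j₀) : ℝ) = (m : ℝ) + γ j₀ →
      (inner ℝ z' (e j₀) : ℝ) = (m : ℝ) + γ j₀ →
      Metric.infDist (f z') (Set.range fun r : ℝ => f z + r • u) ≤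
        2 * ∑ j : Fin n, (1 + |γ j|) := by
  intro z z' hz hz'
  obtain ⟨hC, hS⟩ := sum_cos_sin_aux n hn
  have hin : ∀ (x : EuclideanSpace ℝ (Fin 2)) (j : Fin n), (inner ℝ x (e j) : ℝ) =
      x 0 * Real.cos (2 * Real.pi * ((j : ℕ) : ℝ) / (n : ℝ)) +
      x 1 * Real.sin (2 * Real.pi * ((j : ℕ) : ℝ) / (n : ℝ)) := by
    intro x j
    rw [he j]
    simp [PiLp.inner_apply, Fin.sum_univ_two]
    ring
  have he0 : ∀ j, e j 0 = Real.cos (2 * Real.pi * ((j : ℕ) : ℝ) / (n : ℝ)) := by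
    intro j
    rw [he j]
    simp
  have he1 : ∀ j, e j 1 = Real.sin (2 * Real.pi * ((j : ℕ) : ℝ) / (n : ℝ)) := by
    intro j
    rw [he j]
    simp
  have hu0 : u 0 = -Real.sin (2 * Real.pi * ((j₀ : ℕ) : ℝ) / (n : ℝ)) := by
    rw [hu]
    simp
  have hu1 : u 1 = Real.cos (2 * Real.pi * ((j₀ : ℕ) : ℝ) / (n : ℝ)) := by
    rw [hu]
    simp
  have hnorm : ∀ j, ‖e j‖ = 1 := by
    intro j
    rw [EuclideanSpace.norm_eq, Fin.sum_univ_two, he0, he1]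
    simp
  set θ : Fin n → ℝ := fun j => 2 * Real.pi * ((j : ℕ) : ℝ) / (n : ℝ) with hθ
  have hθj : ∀ j : Fin n, 2 * Real.pi * ((j : ℕ) : ℝ) / (n : ℝ) = θ j := fun _ => rfl
  simp only [hθj] at hin he0 he1 hu0 hu1 hC hS
  have hcc : ∑ j, Real.cos (θ j) * Real.cos (θ j) = n / 2 := by
    have : ∀ j, Real.cos (θ j) * Real.cos (θ j) = 1 / 2 + Real.cos (2 * θ j) / 2 := by
      intro j
      rw [Real.cos_two_mul]
      ring
    simp only [this, Finset.sum_add_distrib, ← Finset.sum_div, hC]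
    simp
    try ring
  have hss : ∑ j, Real.sin (θ j) * Real.sin (θ j) = n / 2 := by
    have : ∀ j, Real.sin (θ j) * Real.sin (θ j) = 1 - Real.cos (θ j) * Real.cos (θ j) := by
      intro j
      linarith [Real.sin_sq_add_cos_sq (θ j), sq (Real.sin (θ j)), sq (Real.cos (θ j))]
    simp only [this, Finset.sum_sub_distrib, hcc]
    simp
    try ring
  have hsc : ∑ j, Real.sin (θ j) * Real.cos (θ j) = 0 := by
    have : ∀ j, Real.sin (θ j) * Real.cos (θ j) = Real.sin (2 * θ j) / 2 := by
      intro j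
      rw [Real.sin_two_mul]
      ring
    simp only [this, ← Finset.sum_div, hS]
    simp
  have frame : ∀ w : EuclideanSpace ℝ (Fin 2),
      ∑ j, (inner ℝ w (e j) : ℝ) • e j = ((n : ℝ) / 2) • w := by
    intro w
    ext i
    fin_cases i
    · have : ∀ j, (w 0 * Real.cos (θ j) + w 1 * Real.sin (θ j)) * Real.cos (θ j) =
          w 0 * (Real.cos (θ j) * Real.cos (θ j)) + w 1 * (Real.sin (θ j) * Real.cos (θ j)) := by
        intro j
        ring
      simp [hin, he0, this, Finset.sum_add_distrib, ← Finset.mul_sum, hcc, hsc]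
      try ring
    · have : ∀ j, (w 0 * Real.cos (θ j) + w 1 * Real.sin (θ j)) * Real.sin (θ j) =
          w 0 * (Real.sin (θ j) * Real.cos (θ j)) + w 1 * (Real.sin (θ j) * Real.sin (θ j)) := by
        intro j
        ring
      simp [hin, he1, this, Finset.sum_add_distrib, ← Finset.mul_sum, hss, hsc]
      try ring
  have hw : (z' - z) 0 * Real.cos (θ j₀) + (z' - z) 1 * Real.sin (θ j₀) = 0 := by
    rw [← hin, inner_sub_left, hz, hz', sub_self]
  set w := z' - z with hwdef
  set t : ℝ := w 1 * Real.cos (θ j₀) - w 0 * Real.sin (θ j₀) with ht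
  have hwu : w = t • u := by
    have h1 := Real.sin_sq_add_cos_sq (θ j₀)
    ext i
    fin_cases i
    · simp only [Fin.zero_eta, PiLp.smul_apply, smul_eq_mul, hu0, ht]
      linear_combination (-(w 0)) * h1 + Real.cos (θ j₀) * hw
    · simp only [Fin.mk_one, PiLp.smul_apply, smul_eq_mul, hu1, ht]
      linear_combination (-(w 1)) * h1 + Real.sin (θ j₀) * hw
  have hmem : f z + ((n : ℝ) / 2 * t) • u ∈ Set.range fun r : ℝ => f z + r • u := ⟨_, rfl⟩
  refine (Metric.infDist_le_dist_of_mem hmem).trans ?_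
  have hdiff : f z' - (f z + ((n : ℝ) / 2 * t) • u) =
      ∑ j, ((((⌈(inner ℝ z' (e j) : ℝ) - γ j⌉ : ℤ) : ℝ) -
        ((⌈(inner ℝ z (e j) : ℝ) - γ j⌉ : ℤ) : ℝ)) - (inner ℝ w (e j) : ℝ)) • e j := by
    simp only [sub_smul, Finset.sum_sub_distrib]
    rw [frame, ← hf, ← hf, mul_smul, ← hwu]
    abel
  rw [dist_eq_norm, hdiff]
  have hb : ∀ j ∈ Finset.univ, ‖((((⌈(inner ℝ z' (e j) : ℝ) - γ j⌉ : ℤ) : ℝ) -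
        ((⌈(inner ℝ z (e j) : ℝ) - γ j⌉ : ℤ) : ℝ)) - (inner ℝ w (e j) : ℝ)) • e j‖
        ≤ 2 * (1 + |γ j|) := by
    intro j _
    rw [norm_smul, hnorm, mul_one, Real.norm_eq_abs, hwdef, inner_sub_left, abs_le]
    have h1 := Int.le_ceil ((inner ℝ z' (e j) : ℝ) - γ j)
    have h2 := Int.ceil_lt_add_one ((inner ℝ z' (e j) : ℝ) - γ j)
    have h3 := Int.le_ceil ((inner ℝ z (e j) : ℝ) - γ j)
    have h4 := Int.ceil_lt_add_one ((inner ℝ z (e j) : ℝ) - γ j)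
    have h5 := abs_nonneg (γ j)
    constructor <;> linarith
  rw [Finset.mul_sum]
  exact norm_sum_le_of_le _ hb
end

section
/- Let n ≥ 3, let e_j = (cos(2πj/n), sin(2πj/n)) ∈ ℝ² for j = 0, …, n−1 be a regular star of unit vectors, fix offsets γ_0, …, γ_{n−1} ∈ ℝ, and define the de Bruijn dual map f : ℝ² → ℝ² by f(z) = Σ_{j<n} ⌈⟨z, e_j⟩ − γ_j⌉ · e_j. Then for every family index j₀ < n, the stacks of family j₀ are relatively dense in the dual tiling: for every z ∈ ℝ² there exists z′ ∈ ℝ² with ⟨z′, e_{j₀}⟩ − γ_{j₀} ∈ ℤ (i.e., z′ lies on a grid line of family j₀) such that ‖f(z) − f(z′)‖ ≤ 3·Σ_{j<n} (1 + |γ_j|). -/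
/-- The stacks of each family `j₀` are uniformly distributed in the de Bruijn dual
tiling: for every point `z` there is a point `z'` on some grid line of family `j₀`
whose dual vertex `f z'` is within distance `3·Σ_j (1 + |γ_j|)` of `f z`. -/
theorem deBruijn_dual_stacks_relatively_dense
    (n : ℕ) (hn : 3 ≤ n)
    (e : Fin n → EuclideanSpace ℝ (Fin 2))
    (he : ∀ j : Fin n, e j = (WithLp.equiv 2 (Fin 2 → ℝ)).symm
      ![Real.cos (2 * Real.pi * ((j : ℕ) : ℝ) / (n : ℝ)),
        Real.sin (2 * Real.pi * ((j : ℕ) : ℝ) / (n : ℝ))])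
    (γ : Fin n → ℝ)
    (f : EuclideanSpace ℝ (Fin 2) → EuclideanSpace ℝ (Fin 2))
    (hf : ∀ z : EuclideanSpace ℝ (Fin 2),
      f z = ∑ j : Fin n, ((⌈(inner ℝ z (e j) : ℝ) - γ j⌉ : ℤ) : ℝ) • e j) :
    ∀ j₀ : Fin n, ∀ z : EuclideanSpace ℝ (Fin 2),
      ∃ z' : EuclideanSpace ℝ (Fin 2),
        (∃ m : ℤ, (inner ℝ z' (e j₀) : ℝ) - γ j₀ = (m : ℝ)) ∧
        ‖f z - f z'‖ ≤ 3 * ∑ j : Fin n, (1 + |γ j|) := by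
  intro j₀ z
  have hnorm : ∀ j, ‖e j‖ = 1 := by
    intro j
    rw [he j, EuclideanSpace.norm_eq]
    simp [Fin.sum_univ_two]
  set x : ℝ := inner ℝ z (e j₀) - γ j₀ with hx
  set t : ℝ := (⌈x⌉ : ℝ) - x with ht
  have ht0 : 0 ≤ t := sub_nonneg.mpr (Int.le_ceil x)
  have ht1 : t ≤ 1 := by
    have := Int.ceil_lt_add_one x
    linarith
  refine ⟨z + t • e j₀, ⟨⌈x⌉, ?_⟩, ?_⟩
  · rw [inner_add_left, real_inner_smul_left, real_inner_self_eq_norm_sq, hnorm]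
    linarith
  · rw [hf, hf, ← Finset.sum_sub_distrib, Finset.mul_sum]
    refine norm_sum_le_of_le _ fun j _ => ?_
    rw [← sub_smul, norm_smul, hnorm, mul_one, Real.norm_eq_abs, inner_add_left,
      real_inner_smul_left]
    have h1 : |(inner ℝ (e j₀) (e j) : ℝ)| ≤ 1 := by
      have := abs_real_inner_le_norm (e j₀) (e j)
      simpa [hnorm] using this
    have h2 : |t * inner ℝ (e j₀) (e j)| ≤ 1 := by
      rw [abs_mul, abs_of_nonneg ht0]
      exact mul_le_one₀ ht1 (abs_nonneg _) h1
    obtain ⟨h3, h4⟩ := abs_le.mp h2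
    have a1 := Int.le_ceil (inner ℝ z (e j) - γ j)
    have a2 := Int.ceil_lt_add_one (inner ℝ z (e j) - γ j)
    have b1 := Int.le_ceil (inner ℝ z (e j) + t * inner ℝ (e j₀) (e j) - γ j)
    have b2 := Int.ceil_lt_add_one (inner ℝ z (e j) + t * inner ℝ (e j₀) (e j) - γ j)
    have hg := abs_nonneg (γ j)
    rw [abs_le]
    constructor <;> linarith
end
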